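/- Let n ≥ 5 be odd. Let A ∈ GL_n(ℤ) be the Levelt companion matrix of P(x) = xⁿ + 3xⁿ⁻¹ + 4xⁿ⁻² + ⋯ + 4x² + 3x + 1 (coefficients a₁ = a_{n−1} = 3 and aᵢ = 4 for 2 ≤ i ≤ n−2) and let B ∈ GL_n(ℤ) be the Levelt companion matrix of Q(x) = xⁿ − 1. Then there exists a nonzero symmetric matrix F ∈ M_n(ℚ) with AᵗFA = F and BᵗFB = F, and for every such F, the subgroup of GL_n(ℤ) generated by A and B has infinite index in the group O_F(ℤ) := {g ∈ GL_n(ℤ) : gᵗFg = F}. (The group ⟨A,B⟩ is the hyperbolic hypergeometric monodromy group of the family 𝒩₂(n−1,1,n); the theorem says it is thin.) -/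

import Mathlib

open Matrix

/-- Cast an integer matrix to a rational matrix. -/
def qm {n : ℕ} (F : Matrix (Fin n) (Fin n) ℤ) : Matrix (Fin n) (Fin n) ℚ :=
  F.map (fun x => (x : ℚ))

/-- The Levelt companion matrix of the monic polynomial
`xⁿ + c 1 * xⁿ⁻¹ + ⋯ + c (n-1) * x + c n`: it has `1`'s in positions `(i+1, i)`,
last column `(-c n, -c (n-1), …, -c 1)ᵗ`, and zeros elsewhere. -/
def levelt (n : ℕ) (c : ℕ → ℤ) : Matrix (Fin n) (Fin n) ℤ :=
  Matrix.of fun i j =>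
    if (j : ℕ) = n - 1 then -c (n - (i : ℕ))
    else if (i : ℕ) = (j : ℕ) + 1 then 1 else 0

/-- The monoid homomorphism `GL_n(ℤ) →* M_n(ℚ)` sending an integral invertible matrix to
its rational incarnation. -/
def glq (n : ℕ) : (Matrix (Fin n) (Fin n) ℤ)ˣ →* Matrix (Fin n) (Fin n) ℚ :=
  ((Int.castRingHom ℚ).mapMatrix.toMonoidHom).comp
    (Units.coeHom (Matrix (Fin n) (Fin n) ℤ))

/-- The integral orthogonal group `O_F(ℤ) = {g ∈ GL_n(ℤ) : gᵗ F g = F}` of a rational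
quadratic form `F`, as a subgroup of `GL_n(ℤ)`. -/
def OFgrp (n : ℕ) (F : Matrix (Fin n) (Fin n) ℚ) :
    Subgroup (Matrix (Fin n) (Fin n) ℤ)ˣ where
  carrier := {g | (glq n g)ᵀ * F * glq n g = F}
  one_mem' := by
    show (glq n 1)ᵀ * F * glq n 1 = F
    rw [_root_.map_one]
    simp
  mul_mem' := by
    intro g h hg hh
    simp only [Set.mem_setOf_eq] at *
    calc (glq n (g * h))ᵀ * F * glq n (g * h)
        = (glq n h)ᵀ * ((glq n g)ᵀ * F * glq n g) * glq n h := by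
          rw [_root_.map_mul, Matrix.transpose_mul]; noncomm_ring
      _ = F := by rw [hg, hh]
  inv_mem' := by
    intro g hg
    simp only [Set.mem_setOf_eq] at *
    have h2 : glq n g * glq n g⁻¹ = 1 := by
      rw [← _root_.map_mul, mul_inv_cancel, _root_.map_one]
    calc (glq n g⁻¹)ᵀ * F * glq n g⁻¹
        = (glq n g⁻¹)ᵀ * ((glq n g)ᵀ * F * glq n g) * glq n g⁻¹ := by rw [hg]
      _ = (glq n g * glq n g⁻¹)ᵀ * F * (glq n g * glq n g⁻¹) := by
          rw [Matrix.transpose_mul]; noncomm_ring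
      _ = F := by rw [h2]; simp

/-- Coefficients of `P(x) = xⁿ + 3xⁿ⁻¹ + 4xⁿ⁻² + ⋯ + 4x² + 3x + 1`. -/
def cP16 (n : ℕ) : ℕ → ℤ := fun k =>
  if k = n then 1
  else if k = 1 ∨ k = n - 1 then 3
  else 4

/-- Coefficients of `Q(x) = xⁿ - 1`. -/
def cQ16 (n : ℕ) : ℕ → ℤ := fun k => if k = n then -1 else 0

/-! ## Simply laced reflection groups -/

section SimplyLaced

variable {V ι : Type*} [AddCommGroup V] [Module ℚ V]

/-- The reflection `x ↦ x - B(b, x) b` in a vector `b` with `B(b, b) = 2`. -/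
def rootReflection (B : LinearMap.BilinForm ℚ V) {b : V} (h : B b b = 2) : V ≃ₗ[ℚ] V :=
  Module.reflection (f := B b) (x := b) h

theorem rootReflection_apply (B : LinearMap.BilinForm ℚ V) {b : V} (h : B b b = 2) (x : V) :
    rootReflection B h x = x - B b x • b :=
  Module.reflection_apply x h

theorem rootReflection_mul_self (B : LinearMap.BilinForm ℚ V) {b : V} (h : B b b = 2) :
    rootReflection B h * rootReflection B h = 1 := by
  ext x
  exact Module.involutive_reflection h x

theorem rootReflection_self (B : LinearMap.BilinForm ℚ V) {b : V} (h : B b b = 2) :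
    rootReflection B h b = -b := by
  rw [rootReflection_apply, h, two_smul]
  abel

/-- Conjugating a root reflection by an isometry gives the reflection in the image root. -/
theorem conj_rootReflection {B : LinearMap.BilinForm ℚ V} {g : V ≃ₗ[ℚ] V}
    (hg : ∀ x y, B (g x) (g y) = B x y) {b c : V} (hb : B b b = 2) (hc : B c c = 2)
    (hbc : g b = c ∨ g b = -c) :
    g * rootReflection B hb * g⁻¹ = rootReflection B hc := by
  ext x
  obtain ⟨y, rfl⟩ := g.surjective x
  have h1 : (g⁻¹ : V ≃ₗ[ℚ] V) (g y) = y := g.symm_apply_apply y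
  have h2 : (g * rootReflection B hb * g⁻¹) (g y) = g y - B (g b) (g y) • g b := by
    change g (rootReflection B hb ((g⁻¹ : V ≃ₗ[ℚ] V) (g y))) = _
    rw [h1, rootReflection_apply, map_sub, map_smul, hg]
  rw [h2, rootReflection_apply]
  rcases hbc with h | h <;> simp [h]

variable (B : LinearMap.BilinForm ℚ V) (α : ι → V) (hα : ∀ i, B (α i) (α i) = 2)

/-- `w` is a product of at most `k` simple reflections. -/
def HasWord (k : ℕ) (w : V ≃ₗ[ℚ] V) : Prop :=
  ∃ l : List ι, l.length ≤ k ∧ (l.map fun i => rootReflection B (hα i)).prod = w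

variable {B α hα}

theorem HasWord.mul_reflection {k : ℕ} {w : V ≃ₗ[ℚ] V} (h : HasWord B α hα k w) (i : ι) :
    HasWord B α hα (k + 1) (w * rootReflection B (hα i)) := by
  obtain ⟨l, hl, rfl⟩ := h
  exact ⟨l ++ [i], by simpa using hl, by simp⟩

theorem HasWord.exists_eq_mul {k : ℕ} {w : V ≃ₗ[ℚ] V} (h : HasWord B α hα k w) :
    w = 1 ∨ ∃ j i w', k = j + 1 ∧ HasWord B α hα j w' ∧ w = w' * rootReflection B (hα i) := by
  obtain ⟨l, hl, rfl⟩ := h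
  rcases List.eq_nil_or_concat l with rfl | ⟨l', i, rfl⟩
  · left; simp
  · right
    simp only [List.concat_eq_append, List.length_append, List.length_cons, List.length_nil] at hl
    exact ⟨k - 1, i, _, by omega, ⟨l', by omega, rfl⟩, by simp⟩

theorem exists_hasWord_of_mem_closure {w : V ≃ₗ[ℚ] V}
    (hw : w ∈ Subgroup.closure (Set.range fun i => rootReflection B (hα i))) :
    ∃ k, HasWord B α hα k w := by
  induction hw using Subgroup.closure_induction_right with
  | one => exact ⟨0, [], by simp, by simp⟩
  | mul_right x y _ hy ih =>
    obtain ⟨i, rfl⟩ := hy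
    obtain ⟨k, hk⟩ := ih
    exact ⟨k + 1, hk.mul_reflection i⟩
  | mul_inv_cancel x y _ hy ih =>
    obtain ⟨i, rfl⟩ := hy
    obtain ⟨k, hk⟩ := ih
    refine ⟨k + 1, ?_⟩
    rw [inv_eq_of_mul_eq_one_left (rootReflection_mul_self B (hα i))]
    exact hk.mul_reflection i

/-- If `w` is a product of `k` simple reflections and `w sᵢ` is not a product of fewer than `k`,
then `w` maps the simple root `αᵢ` into the cone spanned by the simple roots. -/
theorem HasWord.apply_root_mem_closure (hB : ∀ x y, B x y = B y x)
    (hoff : ∀ i j, i ≠ j → B (α i) (α j) = 0 ∨ B (α i) (α j) = -1) (k : ℕ) :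
    ∀ (w : V ≃ₗ[ℚ] V) (i : ι), HasWord B α hα k w →
      (∀ j, HasWord B α hα j (w * rootReflection B (hα i)) → k ≤ j) →
      w (α i) ∈ AddSubmonoid.closure (Set.range α) := by
  induction k using Nat.strong_induction_on with
  | _ k ih =>
  intro w i hw hmin
  have hmem : ∀ j, α j ∈ AddSubmonoid.closure (Set.range α) := fun j =>
    AddSubmonoid.subset_closure ⟨j, rfl⟩
  rcases hw.exists_eq_mul with rfl | ⟨j, t, w', rfl, hw', rfl⟩
  · exact hmem i
  have hti : t ≠ i := by
    rintro rfl
    rw [mul_assoc, rootReflection_mul_self, mul_one] at hmin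
    have := hmin j hw'
    omega
  rcases hoff t i hti with h0 | h1
  · have hfix : rootReflection B (hα t) (α i) = α i := by
      rw [rootReflection_apply, h0, zero_smul, sub_zero]
    have hcomm : rootReflection B (hα t) * rootReflection B (hα i)
        = rootReflection B (hα i) * rootReflection B (hα t) := by
      ext x
      simp only [LinearEquiv.mul_apply, rootReflection_apply, map_sub, map_smul, h0,
        hB (α i) (α t)]
      module
    rw [LinearEquiv.mul_apply, hfix]
    refine ih j (by omega) w' i hw' fun l hl => ?_
    have := hmin (l + 1) (by
      rw [mul_assoc, hcomm, ← mul_assoc]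
      exact hl.mul_reflection t)
    omega
  · have hadd : rootReflection B (hα t) (α i) = α i + α t := by
      rw [rootReflection_apply, h1]
      module
    have hbraid : rootReflection B (hα i) * rootReflection B (hα t) * rootReflection B (hα i)
        = rootReflection B (hα t) * rootReflection B (hα i) * rootReflection B (hα t) := by
      ext x
      simp only [LinearEquiv.mul_apply, rootReflection_apply, map_sub, map_smul, h1,
        hB (α i) (α t), hα]
      module
    by_cases hshort : ∀ l, HasWord B α hα l (w' * rootReflection B (hα i)) → j ≤ l
    · rw [LinearEquiv.mul_apply, hadd, map_add]
      refine add_mem (ih j (by omega) w' i hw' hshort) (ih j (by omega) w' t hw' fun l hl => ?_)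
      have := hmin (l + 1) (hl.mul_reflection i)
      omega
    · push Not at hshort
      obtain ⟨l, hl, hlj⟩ := hshort
      have hw'' : w' = w' * rootReflection B (hα i) * rootReflection B (hα i) := by
        rw [mul_assoc, rootReflection_mul_self, mul_one]
      have happly : (w' * rootReflection B (hα t)) (α i)
          = (w' * rootReflection B (hα i)) (α t) := by
        simp only [LinearEquiv.mul_apply, hadd]
        rw [rootReflection_apply, hB, h1]
        congr 1
        module
      rw [happly]
      refine ih l (by omega) _ t hl fun p hp => ?_
      have := hmin (p + 2) (by
        rw [hw'', mul_assoc, mul_assoc,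
          ← mul_assoc (rootReflection B (hα i)) (rootReflection B (hα t)), hbraid,
          ← mul_assoc, ← mul_assoc]
        exact (hp.mul_reflection i).mul_reflection t)
      omega

/-- The stabiliser of a vector in the open fundamental chamber of a simply laced reflection group
is trivial. -/
theorem eq_one_of_fix_chamber (hB : ∀ x y, B x y = B y x)
    (hoff : ∀ i j, i ≠ j → B (α i) (α j) = 0 ∨ B (α i) (α j) = -1)
    {u : V} (hu : ∀ i, B u (α i) < 0) {w : V ≃ₗ[ℚ] V}
    (hw : w ∈ Subgroup.closure (Set.range fun i => rootReflection B (hα i))) (hwu : w u = u) :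
    w = 1 := by
  classical
  have hiso : ∀ x y, B (w x) (w y) = B x y := by
    clear hwu
    induction hw using Subgroup.closure_induction with
    | one => exact fun _ _ => rfl
    | mem g hg =>
      obtain ⟨i, rfl⟩ := hg
      intro x y
      simp only [rootReflection_apply, map_sub, map_smul, LinearMap.sub_apply,
        LinearMap.smul_apply, hα, hB x (α i), smul_eq_mul]
      ring
    | mul g h _ _ ihg ihh => exact fun x y => (ihg _ _).trans (ihh x y)
    | inv g _ ih =>
      intro x y
      rw [← ih]
      exact congrArg₂ (fun a b => B a b) (g.apply_symm_apply x) (g.apply_symm_apply y)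
  have hex := exists_hasWord_of_mem_closure hw
  rcases (Nat.find_spec hex).exists_eq_mul with h | ⟨j, t, w', hj, hw', hww'⟩
  · exact h
  exfalso
  have hpos : w' (α t) ∈ AddSubmonoid.closure (Set.range α) := by
    refine hw'.apply_root_mem_closure hB hoff j w' t fun l hl => ?_
    rw [← hww'] at hl
    have := Nat.find_min' hex hl
    omega
  have hneg : ∀ x ∈ AddSubmonoid.closure (Set.range α), B u x ≤ 0 := by
    intro x hx
    induction hx using AddSubmonoid.closure_induction with
    | mem x hx => obtain ⟨i, rfl⟩ := hx; exact (hu i).le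
    | zero => simp
    | add x y _ _ hx hy => rw [map_add]; exact add_nonpos hx hy
  have h1 : B u (w (α t)) = B u (α t) := by rw [← hiso u (α t), hwu]
  rw [hww', LinearEquiv.mul_apply, rootReflection_self, map_neg, map_neg] at h1
  have := hneg _ hpos
  have := hu t
  linarith

end SimplyLaced

/-! ## The ideal simplex form and its reflection group -/

section Simplex

/-- The form `B(x, y) = ∑ xᵢ yᵢ - (∑ xᵢ) (∑ yᵢ)`, whose basis vectors are isotropic with
pairwise product `-1`. -/
def simplexForm (n : ℕ) : LinearMap.BilinForm ℚ (Fin n → ℚ) :=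
  LinearMap.mk₂ ℚ (fun x y => x ⬝ᵥ y - (∑ i, x i) * ∑ i, y i)
    (fun x x' y => by simp only [add_dotProduct, Pi.add_apply, Finset.sum_add_distrib]; ring)
    (fun c x y => by
      simp only [smul_dotProduct, Pi.smul_apply, smul_eq_mul, ← Finset.mul_sum]; ring)
    (fun x y y' => by simp only [dotProduct_add, Pi.add_apply, Finset.sum_add_distrib]; ring)
    (fun c x y => by
      simp only [dotProduct_smul, Pi.smul_apply, smul_eq_mul, ← Finset.mul_sum]; ring)

theorem simplexForm_apply {n : ℕ} (x y : Fin n → ℚ) :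
    simplexForm n x y = x ⬝ᵥ y - (∑ i, x i) * ∑ i, y i := rfl

theorem simplexForm_comm {n : ℕ} (x y : Fin n → ℚ) :
    simplexForm n x y = simplexForm n y x := by
  rw [simplexForm_apply, simplexForm_apply, dotProduct_comm, mul_comm]

/-- The standard basis vector. -/
abbrev basisVec {n : ℕ} (i : Fin n) : Fin n → ℚ := Pi.single i 1

theorem simplexForm_basisVec_left {n : ℕ} (i : Fin n) (x : Fin n → ℚ) :
    simplexForm n (basisVec i) x = x i - ∑ j, x j := by
  simp [simplexForm_apply]

/-- Permutations of the coordinates. -/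
def permEquiv (n : ℕ) : Equiv.Perm (Fin n) →* ((Fin n → ℚ) ≃ₗ[ℚ] (Fin n → ℚ)) where
  toFun σ := LinearEquiv.funCongrLeft ℚ ℚ σ⁻¹
  map_one' := rfl
  map_mul' _ _ := by ext; simp [LinearEquiv.funCongrLeft]

theorem permEquiv_apply {n : ℕ} (σ : Equiv.Perm (Fin n)) (x : Fin n → ℚ) (i : Fin n) :
    permEquiv n σ x i = x (σ⁻¹ i) := rfl

theorem permEquiv_basisVec {n : ℕ} (σ : Equiv.Perm (Fin n)) (i : Fin n) :
    permEquiv n σ (basisVec i) = basisVec (σ i) := by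
  ext j
  simp only [permEquiv_apply, Pi.single_apply, Equiv.Perm.inv_eq_iff_eq]

theorem simplexForm_permEquiv {n : ℕ} (σ : Equiv.Perm (Fin n)) (x y : Fin n → ℚ) :
    simplexForm n (permEquiv n σ x) (permEquiv n σ y) = simplexForm n x y := by
  simp only [simplexForm_apply, dotProduct, permEquiv_apply]
  rw [Equiv.sum_comp σ⁻¹ x, Equiv.sum_comp σ⁻¹ y, Equiv.sum_comp σ⁻¹ fun i => x i * y i]

theorem simplexForm_sub_basisVec {n : ℕ} {i j : Fin n} (h : i ≠ j) :
    simplexForm n (basisVec i - basisVec j) (basisVec i - basisVec j) = 2 := by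
  simp only [map_sub, LinearMap.sub_apply, simplexForm_basisVec_left]
  simp [h, h.symm]
  norm_num

theorem rootReflection_sub_basisVec {n : ℕ} {i j : Fin n} (h : i ≠ j) :
    rootReflection (simplexForm n) (simplexForm_sub_basisVec h)
      = permEquiv n (Equiv.swap i j) := by
  refine LinearEquiv.ext fun x => funext fun k => ?_
  rw [rootReflection_apply, permEquiv_apply, map_sub, LinearMap.sub_apply,
    simplexForm_basisVec_left, simplexForm_basisVec_left, Equiv.swap_inv, Equiv.swap_apply_def]
  simp only [Pi.sub_apply, Pi.smul_apply, Pi.single_apply, smul_eq_mul]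
  split_ifs <;> simp_all

theorem simplexForm_long_root {n : ℕ} {i j k : Fin n} (hij : i ≠ j) (hik : i ≠ k) (hjk : j ≠ k) :
    simplexForm n ((2 : ℚ) • basisVec i + basisVec j - basisVec k)
      ((2 : ℚ) • basisVec i + basisVec j - basisVec k) = 2 := by
  simp only [map_sub, map_add, map_smul, LinearMap.sub_apply, LinearMap.add_apply,
    LinearMap.smul_apply, simplexForm_basisVec_left]
  simp [hij, hij.symm, hik, hik.symm, hjk, hjk.symm]
  norm_num

variable (m : ℕ)

/-- The simple roots: the adjacent differences `ε_{i+1} - ε_i` and `2ε₀ + ε₁ - ε_m`. -/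
def simpleRoot : Option (Fin m) → Fin (m + 1) → ℚ
  | some i => basisVec i.succ - basisVec i.castSucc
  | none => (2 : ℚ) • basisVec 0 + basisVec 1 - basisVec (Fin.last m)

variable {m}

theorem simpleRoot_some (i : Fin m) :
    simpleRoot m (some i) = basisVec i.succ - basisVec i.castSucc := rfl

theorem simpleRoot_none :
    simpleRoot m none = (2 : ℚ) • basisVec 0 + basisVec 1 - basisVec (Fin.last m) := rfl

theorem simplexForm_simpleRoot_some (i : Fin m) (x : Fin (m + 1) → ℚ) :
    simplexForm (m + 1) (simpleRoot m (some i)) x = x i.succ - x i.castSucc := by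
  rw [simpleRoot, map_sub, LinearMap.sub_apply, simplexForm_basisVec_left,
    simplexForm_basisVec_left]
  ring

theorem simplexForm_simpleRoot_none (x : Fin (m + 1) → ℚ) :
    simplexForm (m + 1) (simpleRoot m none) x
      = 2 * x 0 + x 1 - x (Fin.last m) - 2 * ∑ j, x j := by
  simp only [simpleRoot, map_sub, map_add, map_smul, LinearMap.sub_apply, LinearMap.add_apply,
    LinearMap.smul_apply, simplexForm_basisVec_left, smul_eq_mul]
  ring

theorem simplexForm_simpleRoot_self (hm : 4 ≤ m) (i : Option (Fin m)) :
    simplexForm (m + 1) (simpleRoot m i) (simpleRoot m i) = 2 := by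
  obtain ⟨p, rfl⟩ := Nat.exists_eq_add_of_le' hm
  rcases i with _ | i
  · exact simplexForm_long_root (by simp) (by simp [Fin.ext_iff])
      (by simp [Fin.ext_iff])
  · exact simplexForm_sub_basisVec i.castSucc_lt_succ.ne'

theorem simplexForm_simpleRoot_of_ne (hm : 4 ≤ m) (i j : Option (Fin m)) (h : i ≠ j) :
    simplexForm (m + 1) (simpleRoot m i) (simpleRoot m j) = 0 ∨
      simplexForm (m + 1) (simpleRoot m i) (simpleRoot m j) = -1 := by
  obtain ⟨p, rfl⟩ := Nat.exists_eq_add_of_le' hm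
  have key : ∀ i : Fin (p + 4), simplexForm _ (simpleRoot _ (some i)) (simpleRoot _ none) = 0 ∨
      simplexForm _ (simpleRoot _ (some i)) (simpleRoot _ none) = -1 := by
    intro i
    rw [simplexForm_simpleRoot_some]
    have := i.isLt
    simp only [simpleRoot, Pi.sub_apply, Pi.add_apply, Pi.smul_apply, Pi.single_apply,
      Fin.ext_iff, Fin.val_succ, Fin.val_castSucc, Fin.val_last, Fin.val_zero, Fin.val_one]
    split_ifs <;> first | contradiction | omega | norm_num
  rcases i with _ | i <;> rcases j with _ | j
  · exact absurd rfl h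
  · rw [simplexForm_comm]
    exact key j
  · exact key i
  · have hij : (i : ℕ) ≠ j := fun h' => h (by rw [Fin.ext h'])
    rw [simplexForm_simpleRoot_some]
    simp only [simpleRoot, Pi.sub_apply, Pi.single_apply, Fin.ext_iff, Fin.val_succ,
      Fin.val_castSucc]
    split_ifs <;> first | contradiction | omega | norm_num

/-- The group generated by the simple reflections. -/
def simplexWeylGroup (hm : 4 ≤ m) : Subgroup ((Fin (m + 1) → ℚ) ≃ₗ[ℚ] (Fin (m + 1) → ℚ)) :=
  Subgroup.closure (Set.range fun i =>
    rootReflection (simplexForm (m + 1)) (simplexForm_simpleRoot_self hm i))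

theorem permEquiv_mem_simplexWeylGroup (hm : 4 ≤ m) (σ : Equiv.Perm (Fin (m + 1))) :
    permEquiv (m + 1) σ ∈ simplexWeylGroup hm := by
  have h : σ ∈ Submonoid.closure
      (Set.range fun i : Fin m => Equiv.swap i.castSucc i.succ) := by
    rw [Equiv.Perm.mclosure_swap_castSucc_succ]
    trivial
  induction h using Submonoid.closure_induction with
  | one => rw [map_one]; exact one_mem _
  | mul x y _ _ hx hy => rw [map_mul]; exact mul_mem hx hy
  | mem x hx =>
    obtain ⟨i, rfl⟩ := hx
    refine Subgroup.subset_closure ⟨some i, ?_⟩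
    dsimp only
    rw [Equiv.swap_comm]
    exact rootReflection_sub_basisVec i.castSucc_lt_succ.ne'

theorem rootReflection_long_root_mem (hm : 4 ≤ m) {k : Fin (m + 1)} (h : (1 : Fin (m + 1)) ≠ 0)
    (h1 : 1 ≠ k) (h0 : 0 ≠ k) :
    rootReflection (simplexForm (m + 1)) (simplexForm_long_root h h1 h0)
      ∈ simplexWeylGroup hm := by
  obtain ⟨p, rfl⟩ := Nat.exists_eq_add_of_le' hm
  have hl0 : (0 : Fin (p + 4 + 1)) ≠ Fin.last (p + 4) := by simp [Fin.ext_iff]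
  have hl1 : (1 : Fin (p + 4 + 1)) ≠ Fin.last (p + 4) := by simp [Fin.ext_iff]
  have hσ := permEquiv_mem_simplexWeylGroup hm
    (Equiv.swap 0 1 * Equiv.swap k (Fin.last (p + 4)))
  rw [← conj_rootReflection
    (simplexForm_permEquiv (Equiv.swap 0 1 * Equiv.swap k (Fin.last (p + 4))))
    (simplexForm_simpleRoot_self hm none)
    (simplexForm_long_root h h1 h0) (Or.inl (by
      simp only [simpleRoot, map_sub, map_add, map_smul, permEquiv_basisVec, Equiv.Perm.mul_apply]
      rw [Equiv.swap_apply_of_ne_of_ne (x := 0) h0 hl0,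
        Equiv.swap_apply_of_ne_of_ne (x := 1) h1 hl1, Equiv.swap_apply_right k,
        Equiv.swap_apply_left, Equiv.swap_apply_right, Equiv.swap_apply_of_ne_of_ne h0.symm h1.symm]))]
  exact mul_mem (mul_mem hσ (Subgroup.subset_closure ⟨none, rfl⟩)) (inv_mem hσ)

/-- The functional `x ↦ 2 ∑ xⱼ - x₀ - x₁`. -/
def edgeFunctional (m : ℕ) : (Fin (m + 1) → ℚ) →ₗ[ℚ] ℚ :=
  -simplexForm (m + 1) (basisVec 0 + basisVec 1)

theorem edgeFunctional_apply (x : Fin (m + 1) → ℚ) :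
    edgeFunctional m x = 2 * ∑ j, x j - x 0 - x 1 := by
  simp only [edgeFunctional, LinearMap.neg_apply, map_add, LinearMap.add_apply,
    simplexForm_basisVec_left]
  ring

theorem edgeFunctional_edge (hm : 4 ≤ m) : edgeFunctional m (basisVec 0 + basisVec 1) = 2 := by
  obtain ⟨p, rfl⟩ := Nat.exists_eq_add_of_le' hm
  rw [edgeFunctional_apply]
  simp [Finset.sum_add_distrib]
  norm_num

/-- The reflection in the midpoint `ε₀ + ε₁` of the edge `01` of the ideal simplex. -/
def edgeReflection (hm : 4 ≤ m) : (Fin (m + 1) → ℚ) ≃ₗ[ℚ] (Fin (m + 1) → ℚ) :=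
  Module.reflection (edgeFunctional_edge hm)

theorem edgeReflection_apply (hm : 4 ≤ m) (x : Fin (m + 1) → ℚ) :
    edgeReflection hm x = x - edgeFunctional m x • (basisVec 0 + basisVec 1) :=
  Module.reflection_apply x (edgeFunctional_edge hm)

theorem edgeReflection_mul_self (hm : 4 ≤ m) : edgeReflection hm * edgeReflection hm = 1 :=
  LinearEquiv.ext (Module.involutive_reflection (edgeFunctional_edge hm))

theorem edgeReflection_inv (hm : 4 ≤ m) : (edgeReflection hm)⁻¹ = edgeReflection hm :=
  inv_eq_of_mul_eq_one_left (edgeReflection_mul_self hm)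

theorem simplexForm_edgeReflection (hm : 4 ≤ m) (x y : Fin (m + 1) → ℚ) :
    simplexForm (m + 1) (edgeReflection hm x) (edgeReflection hm y)
      = simplexForm (m + 1) x y := by
  have h : ∀ z, simplexForm (m + 1) (basisVec 0 + basisVec 1) z = -edgeFunctional m z :=
    fun z => by simp [edgeFunctional]
  rw [edgeReflection_apply, edgeReflection_apply, map_sub, map_sub, LinearMap.sub_apply,
    LinearMap.sub_apply, map_smul, map_smul, map_smul, LinearMap.smul_apply, LinearMap.smul_apply,
    h, h, simplexForm_comm x (basisVec 0 + basisVec 1), h,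
    edgeFunctional_edge hm]
  simp only [smul_eq_mul]
  ring

theorem edgeReflection_zero_one (hm : 4 ≤ m) :
    edgeReflection hm (basisVec 0) = -basisVec 1 ∧ edgeReflection hm (basisVec 1) = -basisVec 0 := by
  obtain ⟨p, rfl⟩ := Nat.exists_eq_add_of_le' hm
  constructor <;>
  · rw [edgeReflection_apply, edgeFunctional_apply]
    simp
    module

theorem edgeReflection_basisVec (hm : 4 ≤ m) {k : Fin (m + 1)} (h0 : 0 ≠ k) (h1 : 1 ≠ k) :
    edgeReflection hm (basisVec k)
      = basisVec k - (2 : ℚ) • (basisVec 0 + basisVec 1) := by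
  rw [edgeReflection_apply, edgeFunctional_apply]
  simp [h0, h1]

/-- Conjugation by the edge reflection preserves the reflection group. -/
theorem conj_edgeReflection_mem (hm : 4 ≤ m)
    {w : (Fin (m + 1) → ℚ) ≃ₗ[ℚ] (Fin (m + 1) → ℚ)} (hw : w ∈ simplexWeylGroup hm) :
    edgeReflection hm * w * edgeReflection hm ∈ simplexWeylGroup hm := by
  have hle : simplexWeylGroup hm ≤
      (simplexWeylGroup hm).comap (MulAut.conj (edgeReflection hm)).toMonoidHom := by
    obtain ⟨p, rfl⟩ := Nat.exists_eq_add_of_le' hm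
    obtain ⟨e0, e1⟩ := edgeReflection_zero_one hm
    have h10 : (1 : Fin (p + 4 + 1)) ≠ 0 := by simp
    conv_lhs => rw [simplexWeylGroup]
    rw [Subgroup.closure_le]
    rintro _ ⟨i, rfl⟩
    change edgeReflection hm * _ * (edgeReflection hm)⁻¹ ∈ simplexWeylGroup hm
    rcases i with _ | i
    · have hl : (0 : Fin (p + 4 + 1)) ≠ Fin.last (p + 4) := by simp [Fin.ext_iff]
      rw [conj_rootReflection (simplexForm_edgeReflection hm) _ (simplexForm_sub_basisVec hl)
        (Or.inl ?_), rootReflection_sub_basisVec hl]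
      · exact permEquiv_mem_simplexWeylGroup hm _
      · rw [simpleRoot_none, map_sub, map_add, map_smul, e0, e1,
          edgeReflection_basisVec hm hl (by simp [Fin.ext_iff])]
        module
    · have hi := i.castSucc_lt_succ.ne'
      by_cases hi0 : (i : ℕ) = 0
      · have hs : i.succ = 1 := by ext; simp [hi0]
        have hc : i.castSucc = 0 := by ext; simp [hi0]
        rw [conj_rootReflection (simplexForm_edgeReflection hm) _ (simplexForm_sub_basisVec hi)
          (Or.inl ?_), rootReflection_sub_basisVec hi]
        · exact permEquiv_mem_simplexWeylGroup hm _
        · rw [simpleRoot_some, hs, hc, map_sub, e0, e1]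
          module
      · have hs0 : 0 ≠ i.succ := i.succ_ne_zero.symm
        have hs1 : 1 ≠ i.succ :=
          Fin.ne_of_val_ne (by rw [Fin.val_one, Fin.val_succ]; omega)
        by_cases hi1 : (i : ℕ) = 1
        · have hc : i.castSucc = 1 := by ext; simp [hi1]
          rw [conj_rootReflection (simplexForm_edgeReflection hm) _
            (simplexForm_long_root h10 hs1 hs0) (Or.inr ?_)]
          · exact rootReflection_long_root_mem hm h10 hs1 hs0
          · rw [simpleRoot_some, hc, map_sub, e1, edgeReflection_basisVec hm hs0 hs1]
            module
        · rw [conj_rootReflection (simplexForm_edgeReflection hm) _ (simplexForm_sub_basisVec hi)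
            (Or.inl ?_), rootReflection_sub_basisVec hi]
          · exact permEquiv_mem_simplexWeylGroup hm _
          · rw [simpleRoot_some, map_sub, edgeReflection_basisVec hm hs0 hs1,
              edgeReflection_basisVec hm (Fin.ne_of_val_ne (Ne.symm hi0))
                (Fin.ne_of_val_ne (Ne.symm hi1))]
            module
  have h := hle hw
  rwa [Subgroup.mem_comap, MulEquiv.coe_toMonoidHom, MulAut.conj_apply, edgeReflection_inv] at h

end Simplex

/-! ## An isotropic vector in the open chamber -/

section Cusp

/-- The open fundamental chamber contains an isotropic vector, and its orthogonal complement
contains an anisotropic vector. -/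
theorem exists_isotropic_chamber_vector {m : ℕ} (hm : 4 ≤ m) :
    ∃ u a : Fin (m + 1) → ℚ, simplexForm (m + 1) u u = 0 ∧
      (∀ i, simplexForm (m + 1) u (simpleRoot m i) < 0) ∧
      simplexForm (m + 1) a u = 0 ∧ simplexForm (m + 1) a a ≠ 0 := by
  obtain ⟨p, rfl⟩ := Nat.exists_eq_add_of_le' hm
  set M : ℚ := ((p + 4 : ℕ) : ℚ) with hM
  have hM4 : 4 ≤ M := by rw [hM]; exact_mod_cast hm
  set N : ℚ := M * (M + 3) + 1 with hN
  set t : Fin (p + 4) → ℚ := fun i => N - (i : ℕ) with ht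
  set S : ℚ := ∑ i, t i with hS
  set Q : ℚ := ∑ i, t i * t i with hQ
  have hNM : 0 < N - M := by nlinarith
  have htlow : ∀ i, N - M ≤ t i := fun i => by
    have : ((i : ℕ) : ℚ) ≤ M := by rw [hM]; exact_mod_cast i.isLt.le
    simp only [ht]; linarith
  have htpos : ∀ i, 0 < t i := fun i => hNM.trans_le (htlow i)
  have hSlow : M * (N - M) ≤ S := by
    have := Finset.card_nsmul_le_sum Finset.univ t (N - M) fun i _ => htlow i
    rwa [Finset.card_univ, Fintype.card_fin, nsmul_eq_mul] at this
  have hSpos : 0 < S := lt_of_lt_of_le (by nlinarith) hSlow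
  have hQlow : (N - M) * S ≤ Q := by
    rw [hS, hQ, Finset.mul_sum]
    exact Finset.sum_le_sum fun i _ => mul_le_mul_of_nonneg_right (htlow i) (htpos i).le
  have hQup : Q ≤ S * S := by
    conv_rhs => rw [hS, Finset.mul_sum]
    exact Finset.sum_le_sum fun i _ => mul_le_mul_of_nonneg_right
      (Finset.single_le_sum (fun j _ => (htpos j).le) (Finset.mem_univ i)) (htpos i).le
  set l : ℚ := -((S * S - Q) / (2 * S)) with hl
  have hl0 : l ≤ 0 := by
    rw [hl, neg_nonpos]
    exact div_nonneg (by linarith) (by linarith)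
  have hlS : 2 * S * l = Q - S * S := by rw [hl]; field_simp; ring
  have hllow : -2 * l ≤ S - (N - M) := by
    have : S * (-2 * l) ≤ S * (S - (N - M)) := by nlinarith
    exact le_of_mul_le_mul_left this hSpos
  set u : Fin (p + 4 + 1) → ℚ := Fin.snoc t l with hu
  have huc : ∀ i : Fin (p + 4), u i.castSucc = t i := fun i => Fin.snoc_castSucc _ _ _
  have hul : u (Fin.last _) = l := Fin.snoc_last _ _
  have hu0 : u 0 = N := by
    have : (0 : Fin (p + 4 + 1)) = Fin.castSucc 0 := rfl
    rw [this, huc]; simp [ht]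
  have hu1 : u 1 = N - 1 := by
    have : (1 : Fin (p + 4 + 1)) = Fin.castSucc 1 := rfl
    rw [this, huc]; simp [ht]
  have hsum : ∑ i, u i = S + l := by
    rw [Fin.sum_univ_castSucc, hul]; simp only [huc, hS]
  have hlong : 2 * u 0 + u 1 - u (Fin.last _) - 2 * ∑ j, u j < 0 := by
    rw [hu0, hu1, hul, hsum]
    nlinarith
  have hs0 : u 0 < ∑ i, u i := by
    rw [hul, hu1] at hlong
    nlinarith
  have hs1 : u 1 < ∑ i, u i := by rw [hu0] at hs0; rw [hu1]; linarith
  have hbasis : simplexForm (p + 4 + 1) (basisVec 0) u = u 0 - ∑ i, u i ∧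
      simplexForm (p + 4 + 1) (basisVec 1) u = u 1 - ∑ i, u i :=
    ⟨simplexForm_basisVec_left _ _, simplexForm_basisVec_left _ _⟩
  refine ⟨u, (∑ i, u i - u 1) • basisVec 0 - (∑ i, u i - u 0) • basisVec 1, ?_, ?_, ?_, ?_⟩
  · rw [simplexForm_apply, hsum, dotProduct, Fin.sum_univ_castSucc, hul]
    simp only [huc, ← hQ]
    linarith
  · intro i
    rw [simplexForm_comm]
    rcases i with _ | i
    · rw [simplexForm_simpleRoot_none]
      exact hlong
    · rw [simplexForm_simpleRoot_some, sub_neg]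
      induction i using Fin.lastCases with
      | last => rw [Fin.succ_last, hul, huc]; exact hl0.trans_lt (htpos _)
      | cast j => rw [Fin.succ_castSucc, huc, huc]; simp [ht]
  · simp only [map_sub, map_smul, LinearMap.sub_apply, LinearMap.smul_apply, hbasis, smul_eq_mul]
    ring
  · simp only [map_sub, map_smul, LinearMap.sub_apply, LinearMap.smul_apply,
      simplexForm_basisVec_left, smul_eq_mul]
    have := mul_pos (sub_pos.2 hs1) (sub_pos.2 hs0)
    simp
    intro h
    nlinarith

end Cusp

/-! ## The intertwiner with the Levelt matrices -/

section Levelt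

variable {m : ℕ}

theorem eq_zero_of_antiperiodic (hm : Even m) {f : Fin (m + 1) → ℚ}
    (hf : ∀ i, f i + f (finRotate (m + 1) i) = 0) : f = 0 := by
  have hpow : ∀ i : Fin (m + 1), f i = (-1) ^ (i : ℕ) * f 0 := by
    intro i
    induction i using Fin.induction with
    | zero => simp
    | succ i ih =>
      have := hf i.castSucc
      rw [finRotate_apply, Fin.coeSucc_eq_succ, ih] at this
      rw [Fin.val_castSucc] at this
      rw [Fin.val_succ, pow_succ]
      linarith
  have h0 : f 0 = 0 := by
    have h1 := hf (Fin.last m)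
    rw [finRotate_last, hpow (Fin.last m), Fin.val_last, hm.neg_one_pow] at h1
    linarith
  ext i
  rw [hpow, h0, mul_zero, Pi.zero_apply]

/-- The map sending `x` to the values of the edge functionals along the cycle of edges. -/
def edgeMap (m : ℕ) : (Fin (m + 1) → ℚ) →ₗ[ℚ] (Fin (m + 1) → ℚ) where
  toFun x i := 2 * ∑ j, x j - x i - x (finRotate (m + 1) i)
  map_add' x y := by
    ext i
    simp only [Pi.add_apply, Finset.sum_add_distrib]
    ring
  map_smul' c x := by
    ext i
    simp only [Pi.smul_apply, smul_eq_mul, ← Finset.mul_sum, RingHom.id_apply]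
    ring

theorem edgeMap_apply (x : Fin (m + 1) → ℚ) (i : Fin (m + 1)) :
    edgeMap m x i = 2 * ∑ j, x j - x i - x (finRotate (m + 1) i) := rfl

theorem edgeMap_injective (hm : 4 ≤ m) (heven : Even m) : Function.Injective (edgeMap m) := by
  rw [injective_iff_map_eq_zero]
  intro x hx
  have hx' : ∀ i, 2 * ∑ j, x j - x i - x (finRotate (m + 1) i) = 0 := fun i => congrFun hx i
  have hsum : ∑ j, x j = 0 := by
    have h := Finset.sum_congr (s₁ := Finset.univ) rfl fun i _ => hx' i
    rw [Finset.sum_sub_distrib, Finset.sum_sub_distrib, Finset.sum_const, Finset.card_univ,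
      Fintype.card_fin, Equiv.sum_comp (finRotate (m + 1)) x, nsmul_eq_mul,
      Finset.sum_const_zero] at h
    have h4 : (4 : ℚ) ≤ m := by exact_mod_cast hm
    have h2 : (2 * (m : ℚ)) * ∑ j, x j = 0 := by push_cast at h; linarith
    exact (mul_eq_zero.mp h2).resolve_left (by linarith)
  refine eq_zero_of_antiperiodic heven fun i => ?_
  have := hx' i
  rw [hsum] at this
  linarith

/-- The edge map as an equivalence. -/
noncomputable def edgeEquiv (hm : 4 ≤ m) (heven : Even m) :
    (Fin (m + 1) → ℚ) ≃ₗ[ℚ] (Fin (m + 1) → ℚ) :=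
  LinearEquiv.ofInjectiveEndo (edgeMap m) (edgeMap_injective hm heven)

theorem edgeEquiv_apply (hm : 4 ≤ m) (heven : Even m) (x : Fin (m + 1) → ℚ) :
    edgeEquiv hm heven x = edgeMap m x := rfl

theorem edgeMap_permEquiv (x : Fin (m + 1) → ℚ) :
    edgeMap m (permEquiv (m + 1) (finRotate (m + 1)) x)
      = permEquiv (m + 1) (finRotate (m + 1)) (edgeMap m x) := by
  ext i
  have h : (finRotate (m + 1))⁻¹ (finRotate (m + 1) i)
      = finRotate (m + 1) ((finRotate (m + 1))⁻¹ i) := by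
    rw [← Equiv.Perm.mul_apply, ← Equiv.Perm.mul_apply, inv_mul_cancel, mul_inv_cancel]
  simp only [edgeMap_apply, permEquiv_apply, Equiv.sum_comp, h]

theorem finRotate_inv_zero : (finRotate (m + 1))⁻¹ 0 = Fin.last m := by
  rw [Equiv.Perm.inv_eq_iff_eq, finRotate_last]

theorem finRotate_inv_succ (i : Fin m) : (finRotate (m + 1))⁻¹ i.succ = i.castSucc := by
  rw [Equiv.Perm.inv_eq_iff_eq, finRotate_apply, Fin.coeSucc_eq_succ]

theorem levelt_mulVec_zero (c : ℕ → ℤ) (y : Fin (m + 1) → ℚ) :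
    (qm (levelt (m + 1) c) *ᵥ y) 0 = -c (m + 1) * y (Fin.last m) := by
  simp only [mulVec, dotProduct, qm, levelt, Matrix.map_apply, Matrix.of_apply,
    Fin.sum_univ_castSucc]
  rw [Finset.sum_eq_zero fun j _ => ?_]
  · simp
  · have := j.isLt
    simp [this.ne]

theorem levelt_mulVec_succ (c : ℕ → ℤ) (y : Fin (m + 1) → ℚ) (i : Fin m) :
    (qm (levelt (m + 1) c) *ᵥ y) i.succ
      = y i.castSucc - c (m - i) * y (Fin.last m) := by
  simp only [mulVec, dotProduct, qm, levelt, Matrix.map_apply, Matrix.of_apply,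
    Fin.sum_univ_castSucc]
  rw [Finset.sum_eq_single i]
  · have := i.isLt
    simp [this.ne, sub_eq_add_neg]
  · intro j _ hj
    have := j.isLt
    have hj' : (i : ℕ) ≠ j := fun h => hj (Fin.ext h.symm)
    simp [this.ne, hj']
  · simp

theorem levelt_cQ16_mulVec (y : Fin (m + 1) → ℚ) :
    qm (levelt (m + 1) (cQ16 (m + 1))) *ᵥ y = permEquiv (m + 1) (finRotate (m + 1)) y := by
  ext i
  rw [permEquiv_apply]
  induction i using Fin.cases with
  | zero => rw [levelt_mulVec_zero, finRotate_inv_zero]; simp [cQ16]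
  | succ i =>
    have : m - (i : ℕ) ≠ m + 1 := by omega
    rw [levelt_mulVec_succ, finRotate_inv_succ]
    simp [cQ16, this]

theorem levelt_cP16_mulVec (hm : 4 ≤ m) (y : Fin (m + 1) → ℚ) :
    qm (levelt (m + 1) (cP16 (m + 1))) *ᵥ y
      = permEquiv (m + 1) (finRotate (m + 1)) y
        - y (Fin.last m) • edgeMap m (basisVec 0 + basisVec 1) := by
  obtain ⟨p, rfl⟩ := Nat.exists_eq_add_of_le' hm
  have hv : ∀ i, edgeMap (p + 4) (basisVec 0 + basisVec 1) i = 4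
      - (basisVec 0 + basisVec 1 : Fin (p + 4 + 1) → ℚ) i
      - (basisVec 0 + basisVec 1 : Fin (p + 4 + 1) → ℚ) (finRotate (p + 4 + 1) i) := by
    intro i
    rw [edgeMap_apply]
    simp [Finset.sum_add_distrib]
    norm_num
  ext i
  rw [Pi.sub_apply, Pi.smul_apply, permEquiv_apply, hv, smul_eq_mul]
  induction i using Fin.cases with
  | zero =>
    rw [levelt_mulVec_zero, finRotate_inv_zero, finRotate_apply]
    simp [cP16]
    ring
  | succ i =>
    have hi := i.isLt
    rw [levelt_mulVec_succ, finRotate_inv_succ]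
    congr 1
    rw [mul_comm]
    congr 1
    have hrot0 : finRotate (p + 4 + 1) i.succ = 0 ↔ (i : ℕ) = p + 3 := by
      rw [← Equiv.Perm.eq_inv_iff_eq, finRotate_inv_zero, Fin.ext_iff, Fin.val_succ, Fin.val_last]
      omega
    have hrot1 : finRotate (p + 4 + 1) i.succ ≠ 1 := by
      rw [finRotate_apply, ne_eq, add_eq_right]
      exact i.succ_ne_zero
    have hi1 : i.succ = 1 ↔ (i : ℕ) = 0 := by
      rw [Fin.ext_iff, Fin.val_succ, Fin.val_one]
      omega
    simp only [cP16, Pi.add_apply, Pi.single_apply, hrot0, hrot1, hi1, i.succ_ne_zero, if_false]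
    split_ifs <;> first | omega | norm_num

theorem levelt_cQ16_edgeMap (x : Fin (m + 1) → ℚ) :
    qm (levelt (m + 1) (cQ16 (m + 1))) *ᵥ edgeMap m x
      = edgeMap m (permEquiv (m + 1) (finRotate (m + 1)) x) := by
  rw [levelt_cQ16_mulVec, edgeMap_permEquiv]

theorem levelt_cP16_edgeMap (hm : 4 ≤ m) (x : Fin (m + 1) → ℚ) :
    qm (levelt (m + 1) (cP16 (m + 1))) *ᵥ edgeMap m x
      = edgeMap m (edgeReflection hm (permEquiv (m + 1) (finRotate (m + 1)) x)) := by
  have h1 : (finRotate (m + 1))⁻¹ 1 = 0 := by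
    rw [Equiv.Perm.inv_eq_iff_eq, finRotate_apply, zero_add]
  have h : edgeMap m x (Fin.last m)
      = edgeFunctional m (permEquiv (m + 1) (finRotate (m + 1)) x) := by
    rw [edgeMap_apply, edgeFunctional_apply, finRotate_last]
    simp only [permEquiv_apply, Equiv.sum_comp, finRotate_inv_zero, h1]
  rw [levelt_cP16_mulVec hm, edgeReflection_apply, map_sub, map_smul, edgeMap_permEquiv, h]

end Levelt

/-! ## The invariant form -/

section InvariantForm

variable {m : ℕ}

theorem eq_of_dotProduct_mulVec_eq {n : ℕ} {X Y : Matrix (Fin n) (Fin n) ℚ}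
    (h : ∀ y z, y ⬝ᵥ X *ᵥ z = y ⬝ᵥ Y *ᵥ z) : X = Y := by
  ext i j
  simpa using h (Pi.single i 1) (Pi.single j 1)

theorem mulVec_dotProduct_mulVec_mulVec {n : ℕ} (M F : Matrix (Fin n) (Fin n) ℚ)
    (y z : Fin n → ℚ) : (M *ᵥ y) ⬝ᵥ F *ᵥ (M *ᵥ z) = y ⬝ᵥ (Mᵀ * F * M) *ᵥ z := by
  rw [Matrix.mul_assoc, ← mulVec_mulVec, ← mulVec_mulVec, dotProduct_mulVec y, vecMul_transpose]

/-- Invariance of a form can be checked along the edge map. -/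
theorem transpose_mul_mul_eq_of_edgeMap (hm : 4 ≤ m) (heven : Even m)
    {M F : Matrix (Fin (m + 1)) (Fin (m + 1)) ℚ}
    (h : ∀ x z, (M *ᵥ edgeMap m x) ⬝ᵥ F *ᵥ (M *ᵥ edgeMap m z)
      = edgeMap m x ⬝ᵥ F *ᵥ edgeMap m z) : Mᵀ * F * M = F := by
  refine eq_of_dotProduct_mulVec_eq fun y z => ?_
  obtain ⟨y, rfl⟩ := (edgeEquiv hm heven).surjective y
  obtain ⟨z, rfl⟩ := (edgeEquiv hm heven).surjective z
  rw [← mulVec_dotProduct_mulVec_mulVec]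
  exact h y z

/-- A form invariant under the rotation and the edge reflection is a multiple of the simplex
form. -/
theorem exists_eq_smul_simplexForm (hm : 4 ≤ m) (heven : Even m)
    {G : LinearMap.BilinForm ℚ (Fin (m + 1) → ℚ)}
    (hP : ∀ x z, G (permEquiv (m + 1) (finRotate (m + 1)) x)
      (permEquiv (m + 1) (finRotate (m + 1)) z) = G x z)
    (hR : ∀ x z, G (edgeReflection hm x) (edgeReflection hm z) = G x z) :
    ∃ c : ℚ, G = c • simplexForm (m + 1) := by
  set v : Fin (m + 1) → ℚ := basisVec 0 + basisVec 1 with hv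
  set D := G - (-(G v v) / 2) • simplexForm (m + 1) with hD
  have hRv : edgeReflection hm v = -v := by
    rw [edgeReflection_apply, edgeFunctional_edge hm]
    module
  have hDP : ∀ x z, D (permEquiv (m + 1) (finRotate (m + 1)) x)
      (permEquiv (m + 1) (finRotate (m + 1)) z) = D x z := fun x z => by
    simp only [hD, LinearMap.sub_apply, LinearMap.smul_apply, hP, simplexForm_permEquiv]
  have hD0 : ∀ x, D x v = 0 := fun x => by
    have h := hR x v
    rw [hRv, edgeReflection_apply, map_neg, map_sub, map_smul, LinearMap.sub_apply,
      LinearMap.smul_apply, smul_eq_mul] at h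
    have he : simplexForm (m + 1) x v = -edgeFunctional m x := by
      rw [simplexForm_comm, edgeFunctional, LinearMap.neg_apply, neg_neg]
    simp only [hD, LinearMap.sub_apply, LinearMap.smul_apply, he, smul_eq_mul]
    linarith
  have hDi : ∀ (i : Fin (m + 1)) (x),
      D x (basisVec i + basisVec (finRotate (m + 1) i)) = 0 := by
    intro i
    induction i using Fin.induction with
    | zero =>
      intro x
      rw [finRotate_apply, zero_add]
      exact hD0 x
    | succ i ih =>
      intro x
      obtain ⟨x, rfl⟩ := (permEquiv (m + 1) (finRotate (m + 1))).surjective x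
      have h : i.succ = finRotate (m + 1) i.castSucc := by
        rw [finRotate_apply, Fin.coeSucc_eq_succ]
      rw [h, ← permEquiv_basisVec, ← permEquiv_basisVec, ← map_add, hDP]
      exact ih x
  refine ⟨-(G v v) / 2, sub_eq_zero.1 ?_⟩
  refine LinearMap.ext fun x => (Pi.basisFun ℚ (Fin (m + 1))).ext fun i => ?_
  have h := eq_zero_of_antiperiodic heven (f := fun i => D x (basisVec i)) fun i => by
    rw [← map_add]
    exact hDi i x
  rw [Pi.basisFun_apply]
  exact congrFun h i

theorem exists_form_edgeMap_eq (hm : 4 ≤ m) (heven : Even m)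
    {F : Matrix (Fin (m + 1)) (Fin (m + 1)) ℚ}
    (hA : (qm (levelt (m + 1) (cP16 (m + 1))))ᵀ * F * qm (levelt (m + 1) (cP16 (m + 1))) = F)
    (hB : (qm (levelt (m + 1) (cQ16 (m + 1))))ᵀ * F * qm (levelt (m + 1) (cQ16 (m + 1))) = F) :
    ∃ c : ℚ, ∀ x z, edgeMap m x ⬝ᵥ F *ᵥ edgeMap m z = c * simplexForm (m + 1) x z := by
  have hG : ∀ x z, (Matrix.toBilin' F).comp (edgeMap m) (edgeMap m) x z
      = edgeMap m x ⬝ᵥ F *ᵥ edgeMap m z := fun x z => by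
    rw [LinearMap.BilinForm.comp_apply, Matrix.toBilin'_apply']
  have hP : ∀ x z, edgeMap m (permEquiv (m + 1) (finRotate (m + 1)) x) ⬝ᵥ F *ᵥ
      edgeMap m (permEquiv (m + 1) (finRotate (m + 1)) z)
      = edgeMap m x ⬝ᵥ F *ᵥ edgeMap m z := fun x z => by
    rw [← levelt_cQ16_edgeMap, ← levelt_cQ16_edgeMap, mulVec_dotProduct_mulVec_mulVec, hB]
  obtain ⟨c, hc⟩ := exists_eq_smul_simplexForm hm heven
    (G := (Matrix.toBilin' F).comp (edgeMap m) (edgeMap m))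
    (fun x z => by rw [hG, hG, hP]) fun x z => by
      obtain ⟨x, rfl⟩ := (permEquiv (m + 1) (finRotate (m + 1))).surjective x
      obtain ⟨z, rfl⟩ := (permEquiv (m + 1) (finRotate (m + 1))).surjective z
      rw [hG, hG, hP, ← levelt_cP16_edgeMap, ← levelt_cP16_edgeMap,
        mulVec_dotProduct_mulVec_mulVec, hA]
  exact ⟨c, fun x z => by rw [← hG, hc]; rfl⟩

theorem exists_invariant_form (hm : 4 ≤ m) (heven : Even m) :
    ∃ F : Matrix (Fin (m + 1)) (Fin (m + 1)) ℚ, F ≠ 0 ∧ F.IsSymm ∧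
      (qm (levelt (m + 1) (cP16 (m + 1))))ᵀ * F * qm (levelt (m + 1) (cP16 (m + 1))) = F ∧
      (qm (levelt (m + 1) (cQ16 (m + 1))))ᵀ * F * qm (levelt (m + 1) (cQ16 (m + 1))) = F := by
  let E := edgeEquiv hm heven
  let F : Matrix (Fin (m + 1)) (Fin (m + 1)) ℚ := LinearMap.BilinForm.toMatrix'
    ((simplexForm (m + 1)).comp E.symm.toLinearMap E.symm.toLinearMap)
  have hF' : ∀ y z, y ⬝ᵥ F *ᵥ z = simplexForm (m + 1) (E.symm y) (E.symm z) := fun y z => by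
    rw [← Matrix.toBilin'_apply', Matrix.toBilin'_toMatrix']
    rfl
  have hF : ∀ x z, edgeMap m x ⬝ᵥ F *ᵥ edgeMap m z = simplexForm (m + 1) x z := fun x z => by
    rw [hF', ← edgeEquiv_apply hm heven x, ← edgeEquiv_apply hm heven z,
      LinearEquiv.symm_apply_apply, LinearEquiv.symm_apply_apply]
  refine ⟨F, fun h0 => ?_, ?_, ?_, ?_⟩
  · obtain ⟨u, a, -, -, -, ha⟩ := exists_isotropic_chamber_vector hm
    refine ha ?_
    rw [← hF, h0, zero_mulVec, dotProduct_zero]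
  · refine eq_of_dotProduct_mulVec_eq fun y z => ?_
    rw [mulVec_transpose, dotProduct_comm, ← dotProduct_mulVec, hF', hF', simplexForm_comm]
  · refine transpose_mul_mul_eq_of_edgeMap hm heven fun x z => ?_
    rw [levelt_cP16_edgeMap hm, levelt_cP16_edgeMap hm, hF, hF, simplexForm_edgeReflection,
      simplexForm_permEquiv]
  · refine transpose_mul_mul_eq_of_edgeMap hm heven fun x z => ?_
    rw [levelt_cQ16_edgeMap, levelt_cQ16_edgeMap, hF, hF, simplexForm_permEquiv]

end InvariantForm

/-! ## The monodromy group inside the extended reflection group -/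

section Monodromy

variable {m : ℕ}

/-- The group generated by the simple reflections and the edge reflection, which normalizes
them. -/
def extendedWeylGroup (hm : 4 ≤ m) : Subgroup ((Fin (m + 1) → ℚ) ≃ₗ[ℚ] (Fin (m + 1) → ℚ)) where
  carrier := {h | h ∈ simplexWeylGroup hm ∨ edgeReflection hm * h ∈ simplexWeylGroup hm}
  one_mem' := Or.inl (one_mem _)
  mul_mem' := by
    have hR := edgeReflection_mul_self hm
    rintro g h (hg | hg) (hh | hh)
    · exact Or.inl (mul_mem hg hh)
    · refine Or.inr ?_
      have := mul_mem (conj_edgeReflection_mem hm hg) hh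
      rwa [mul_assoc, ← mul_assoc _ _ h, hR, one_mul, mul_assoc] at this
    · refine Or.inr ?_
      rw [← mul_assoc]
      exact mul_mem hg hh
    · refine Or.inl ?_
      have := mul_mem (conj_edgeReflection_mem hm hg) hh
      rwa [← mul_assoc _ _ g, hR, one_mul, mul_assoc, ← mul_assoc _ _ h, hR, one_mul] at this
  inv_mem' := by
    have hR := edgeReflection_mul_self hm
    rintro g (hg | hg)
    · exact Or.inl (inv_mem hg)
    · refine Or.inr ?_
      have := conj_edgeReflection_mem hm (inv_mem hg)
      rwa [_root_.mul_inv_rev, edgeReflection_inv, mul_assoc, mul_assoc, hR, mul_one] at this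

theorem mul_self_mem_simplexWeylGroup (hm : 4 ≤ m)
    {h : (Fin (m + 1) → ℚ) ≃ₗ[ℚ] (Fin (m + 1) → ℚ)} (hh : h ∈ extendedWeylGroup hm) :
    h * h ∈ simplexWeylGroup hm := by
  have hR := edgeReflection_mul_self hm
  rcases hh with hh | hh
  · exact mul_mem hh hh
  · have := mul_mem (conj_edgeReflection_mem hm hh) hh
    rwa [← mul_assoc _ _ h, ← mul_assoc (edgeReflection hm), hR, one_mul, mul_assoc h, hR,
      mul_one] at this

theorem exists_mem_extendedWeylGroup (hm : 4 ≤ m)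
    {gA gB h : (Matrix (Fin (m + 1)) (Fin (m + 1)) ℤ)ˣ}
    (hA : (gA : Matrix (Fin (m + 1)) (Fin (m + 1)) ℤ) = levelt (m + 1) (cP16 (m + 1)))
    (hB : (gB : Matrix (Fin (m + 1)) (Fin (m + 1)) ℤ) = levelt (m + 1) (cQ16 (m + 1)))
    (hh : h ∈ Subgroup.closure {gA, gB}) :
    ∃ w ∈ extendedWeylGroup hm, ∀ x, glq (m + 1) h *ᵥ edgeMap m x = edgeMap m (w x) := by
  have hPW := permEquiv_mem_simplexWeylGroup hm (finRotate (m + 1))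
  induction hh using Subgroup.closure_induction with
  | mem x hx =>
    rcases hx with rfl | rfl
    · refine ⟨edgeReflection hm * permEquiv (m + 1) (finRotate (m + 1)), Or.inr ?_, fun x => ?_⟩
      · rwa [← mul_assoc, edgeReflection_mul_self, one_mul]
      · refine Eq.trans ?_ (levelt_cP16_edgeMap hm x)
        rw [← hA]
        rfl
    · refine ⟨permEquiv (m + 1) (finRotate (m + 1)), Or.inl hPW, fun x => ?_⟩
      refine Eq.trans ?_ (levelt_cQ16_edgeMap x)
      rw [← hB]
      rfl
  | one => exact ⟨1, one_mem _, fun x => by rw [map_one, one_mulVec]; rfl⟩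
  | mul g h _ _ ihg ihh =>
    obtain ⟨v, hv, hgv⟩ := ihg
    obtain ⟨w, hw, hhw⟩ := ihh
    refine ⟨v * w, mul_mem hv hw, fun x => ?_⟩
    rw [map_mul, ← mulVec_mulVec, hhw, hgv]
    rfl
  | inv g _ ihg =>
    obtain ⟨w, hw, hgw⟩ := ihg
    refine ⟨w⁻¹, inv_mem hw, fun x => ?_⟩
    have h : w (w⁻¹ x) = x := w.apply_symm_apply x
    have h' := hgw (w⁻¹ x)
    rw [h] at h'
    rw [← h', mulVec_mulVec, ← map_mul, inv_mul_cancel, map_one, one_mulVec]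

end Monodromy

/-! ## Unipotent isometries at the cusp -/

section Unipotent

variable {m : ℕ}

/-- Every rational endomorphism has a nonzero multiple which is integral in edge coordinates. -/
theorem exists_integral_multiple (hm : 4 ≤ m) (heven : Even m)
    (T : (Fin (m + 1) → ℚ) →ₗ[ℚ] (Fin (m + 1) → ℚ)) :
    ∃ (d : ℚ) (N : Matrix (Fin (m + 1)) (Fin (m + 1)) ℤ), d ≠ 0 ∧
      ∀ x, qm N *ᵥ edgeMap m x = edgeMap m (d • T x) := by
  let E := edgeEquiv hm heven
  let X : Matrix (Fin (m + 1)) (Fin (m + 1)) ℚ :=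
    LinearMap.toMatrix' (E.toLinearMap ∘ₗ T ∘ₗ E.symm.toLinearMap)
  obtain ⟨b, hb⟩ := IsLocalization.exist_integer_multiples_of_finite (nonZeroDivisors ℤ)
    fun p : Fin (m + 1) × Fin (m + 1) => X p.1 p.2
  choose N hN using hb
  refine ⟨(b : ℤ), Matrix.of fun i j => N (i, j), by simp, fun x => ?_⟩
  have hX : qm (Matrix.of fun i j => N (i, j)) = ((b : ℤ) : ℚ) • X := by
    ext i j
    have := hN (i, j)
    simpa [qm] using this
  rw [hX, smul_mulVec, map_smul, LinearMap.toMatrix'_mulVec, ← edgeEquiv_apply hm heven x,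
    ← edgeEquiv_apply hm heven (T x)]
  simp [E]

/-- An integral isometry fixing an isotropic chamber vector and acting on the orthogonal vector
`a` by a nontrivial transvection. -/
theorem exists_unipotent (hm : 4 ≤ m) (heven : Even m) :
    ∃ (u a : Fin (m + 1) → ℚ) (g : (Matrix (Fin (m + 1)) (Fin (m + 1)) ℤ)ˣ),
      (∀ i, simplexForm (m + 1) u (simpleRoot m i) < 0) ∧
      glq (m + 1) g *ᵥ edgeMap m u = edgeMap m u ∧
      (∃ t : ℚ, t ≠ 0 ∧ glq (m + 1) g *ᵥ edgeMap m a = edgeMap m (a + t • u)) ∧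
      ∀ (F : Matrix (Fin (m + 1)) (Fin (m + 1)) ℚ) (c : ℚ),
        (∀ x z, edgeMap m x ⬝ᵥ F *ᵥ edgeMap m z = c * simplexForm (m + 1) x z) →
          g ∈ OFgrp (m + 1) F := by
  obtain ⟨u, a, huu, hu, hau, haa⟩ := exists_isotropic_chamber_vector hm
  have hua : simplexForm (m + 1) u a = 0 := by rw [simplexForm_comm, hau]
  obtain ⟨d, N, hd, hN⟩ := exists_integral_multiple hm heven
    ((simplexForm (m + 1) u).smulRight a - (simplexForm (m + 1) a).smulRight u)
  set T := d • ((simplexForm (m + 1) u).smulRight a - (simplexForm (m + 1) a).smulRight u) with hT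
  have hTx : ∀ x, T x = d • (simplexForm (m + 1) u x • a - simplexForm (m + 1) a x • u) :=
    fun x => rfl
  have hT3 : ∀ x, T (T (T x)) = 0 := fun x => by
    simp only [hTx, map_smul, map_sub, huu, hau, hua, smul_eq_mul]
    simp
  have hN' : ∀ x, qm N *ᵥ edgeMap m x = edgeMap m (T x) := hN
  have hN3 : N * N * N = 0 := by
    have h : qm (N * N * N) = 0 := by
      refine eq_of_dotProduct_mulVec_eq fun y z => ?_
      obtain ⟨z, rfl⟩ := (edgeEquiv hm heven).surjective z
      have hq : qm (N * N * N) = qm N * qm N * qm N := by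
        simp only [qm, ← Int.coe_castRingHom, Matrix.map_mul]
      rw [hq, edgeEquiv_apply, ← mulVec_mulVec, ← mulVec_mulVec, hN', hN', hN', hT3, map_zero,
        zero_mulVec]
    exact Matrix.map_injective Int.cast_injective (h.trans (Matrix.map_zero _ Int.cast_zero).symm)
  have hinv : ∀ X : Matrix (Fin (m + 1)) (Fin (m + 1)) ℤ, X * X * X = 0 →
      (1 + 2 • X + 2 • (X * X)) * (1 - 2 • X + 2 • (X * X)) = 1 ∧
      (1 - 2 • X + 2 • (X * X)) * (1 + 2 • X + 2 • (X * X)) = 1 := fun X hX => by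
    have hX4 : X * X * (X * X) = 0 := by rw [← mul_assoc, hX, zero_mul]
    have hX' : X * (X * X) = 0 := by rw [← mul_assoc, hX]
    constructor <;>
    · simp only [add_mul, mul_add, sub_mul, mul_sub, one_mul, mul_one, smul_mul_assoc,
        mul_smul_comm, hX, hX', hX4, smul_zero]
      abel
  let g : (Matrix (Fin (m + 1)) (Fin (m + 1)) ℤ)ˣ :=
    ⟨1 + 2 • N + 2 • (N * N), 1 - 2 • N + 2 • (N * N), (hinv N hN3).1, (hinv N hN3).2⟩
  have hg : ∀ x, glq (m + 1) g *ᵥ edgeMap m x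
      = edgeMap m (x + (2 : ℚ) • T x + (2 : ℚ) • T (T x)) := fun x => by
    have hq : glq (m + 1) g = 1 + (2 : ℚ) • qm N + (2 : ℚ) • (qm N * qm N) := by
      change (Int.castRingHom ℚ).mapMatrix (1 + 2 • N + 2 • (N * N)) = _
      rw [map_add, map_add, map_one, map_nsmul, map_nsmul, map_mul, ← ofNat_smul_eq_nsmul ℚ,
        ← ofNat_smul_eq_nsmul ℚ]
      rfl
    rw [hq, add_mulVec, add_mulVec, one_mulVec, smul_mulVec, smul_mulVec, ← mulVec_mulVec, hN',
      hN', map_add, map_add, map_smul, map_smul]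
  have hTu : T u = 0 := by rw [hTx, huu, hau]; simp
  refine ⟨u, a, g, hu, ?_, ⟨-2 * d * simplexForm (m + 1) a a, by simp [hd, haa], ?_⟩, ?_⟩
  · rw [hg, hTu]
    simp
  · have hTa : T a = (-d * simplexForm (m + 1) a a) • u := by
      rw [hTx, hua]
      module
    rw [hg, hTa, map_smul, hTu]
    congr 1
    module
  · intro F c hF
    refine transpose_mul_mul_eq_of_edgeMap hm heven fun x z => ?_
    rw [hg, hg, hF, hF]
    congr 1
    simp only [hTx, map_add, map_sub, map_smul, LinearMap.add_apply, LinearMap.sub_apply,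
      LinearMap.smul_apply, smul_eq_mul, huu, hau, hua, simplexForm_comm x u,
      simplexForm_comm x a]
    ring

end Unipotent

/-- The monodromy group has infinite index in the integral orthogonal group of any invariant
form. -/
theorem relIndex_closure_eq_zero {m : ℕ} (hm : 4 ≤ m) (heven : Even m)
    {F : Matrix (Fin (m + 1)) (Fin (m + 1)) ℚ}
    (hA : (qm (levelt (m + 1) (cP16 (m + 1))))ᵀ * F * qm (levelt (m + 1) (cP16 (m + 1))) = F)
    (hB : (qm (levelt (m + 1) (cQ16 (m + 1))))ᵀ * F * qm (levelt (m + 1) (cQ16 (m + 1))) = F)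
    {gA gB : (Matrix (Fin (m + 1)) (Fin (m + 1)) ℤ)ˣ}
    (hgA : (gA : Matrix (Fin (m + 1)) (Fin (m + 1)) ℤ) = levelt (m + 1) (cP16 (m + 1)))
    (hgB : (gB : Matrix (Fin (m + 1)) (Fin (m + 1)) ℤ) = levelt (m + 1) (cQ16 (m + 1))) :
    (Subgroup.closure {gA, gB}).relIndex (OFgrp (m + 1) F) = 0 := by
  by_contra hindex
  obtain ⟨c, hc⟩ := exists_form_edgeMap_eq hm heven hA hB
  obtain ⟨u, a, g, hu, hgu, ⟨t, ht, hga⟩, hg⟩ := exists_unipotent hm heven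
  obtain ⟨k, hk, -, hgk⟩ := Subgroup.exists_pow_mem_of_relIndex_ne_zero hindex (hg F c hc)
  obtain ⟨w, hw, hwx⟩ := exists_mem_extendedWeylGroup hm hgA hgB hgk.1
  have hinj := edgeMap_injective hm heven
  have hpow : ∀ (j : ℕ) (b : ℚ), glq (m + 1) (g ^ j) *ᵥ edgeMap m (a + b • u)
      = edgeMap m (a + (b + j * t) • u) := by
    intro j
    induction j with
    | zero => intro b; simp
    | succ j ih =>
      intro b
      rw [pow_succ, map_mul, ← mulVec_mulVec, map_add, map_smul, mulVec_add, mulVec_smul, hgu, hga,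
        ← map_smul, ← map_add, add_assoc, ← add_smul, ih]
      congr 3
      push_cast
      ring
  have hpowu : ∀ j : ℕ, glq (m + 1) (g ^ j) *ᵥ edgeMap m u = edgeMap m u := by
    intro j
    induction j with
    | zero => simp
    | succ j ih => rw [pow_succ, map_mul, ← mulVec_mulVec, hgu, ih]
  have hwu : w u = u := hinj (by rw [← hwx, hpowu])
  have hwa : ∀ b : ℚ, w (a + b • u) = a + (b + k * t) • u :=
    fun b => hinj (by rw [← hwx, hpow])
  have hone : w * w = 1 := eq_one_of_fix_chamber simplexForm_comm (simplexForm_simpleRoot_of_ne hm)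
    hu (mul_self_mem_simplexWeylGroup hm hw)
    (by rw [LinearEquiv.mul_apply, hwu, hwu])
  have h := LinearEquiv.congr_fun hone (a + (0 : ℚ) • u)
  rw [LinearEquiv.mul_apply, hwa, hwa] at h
  replace h := add_left_cancel (h : _ = a + (0 : ℚ) • u)
  have hu0 : u ≠ 0 := fun h0 => by
    have := hu none
    rw [h0, map_zero, LinearMap.zero_apply] at this
    exact this.false
  have hk' : (0 : ℚ) < k := by exact_mod_cast hk
  have h2 := smul_left_injective ℚ hu0 h
  have h3 : (2 * (k : ℚ)) * t = 0 := by linarith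
  exact ht ((mul_eq_zero.1 h3).resolve_left (by positivity))

theorem stmt16 (n : ℕ) (hn : 5 ≤ n) (hodd : Odd n) :
    (∃ F : Matrix (Fin n) (Fin n) ℚ, F ≠ 0 ∧ F.IsSymm ∧
      (qm (levelt n (cP16 n)))ᵀ * F * qm (levelt n (cP16 n)) = F ∧
      (qm (levelt n (cQ16 n)))ᵀ * F * qm (levelt n (cQ16 n)) = F) ∧
    ∀ F : Matrix (Fin n) (Fin n) ℚ, F ≠ 0 → F.IsSymm →
      (qm (levelt n (cP16 n)))ᵀ * F * qm (levelt n (cP16 n)) = F →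
      (qm (levelt n (cQ16 n)))ᵀ * F * qm (levelt n (cQ16 n)) = F →
      ∀ gA gB : (Matrix (Fin n) (Fin n) ℤ)ˣ,
        (gA : Matrix (Fin n) (Fin n) ℤ) = levelt n (cP16 n) →
        (gB : Matrix (Fin n) (Fin n) ℤ) = levelt n (cQ16 n) →
        (Subgroup.closure {gA, gB}).relIndex (OFgrp n F) = 0 := by
  obtain ⟨m, rfl⟩ : ∃ m, n = m + 1 := ⟨n - 1, by omega⟩
  have hm : 4 ≤ m := by omega
  have heven : Even m := by
    rw [Nat.odd_add_one, Nat.not_odd_iff_even] at hodd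
    exact hodd
  exact ⟨exists_invariant_form hm heven, fun F _ _ hA hB gA gB hgA hgB =>
    relIndex_closure_eq_zero hm heven hA hB hgA hgB⟩
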